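/- Let ε > 0, β ∈ ℝ, g ∈ ℝ, and let φ : ℝ × ℝ → ℂ be a smooth solution of the 1D cubic-quintic NLS equation i ∂_t φ = −∂_x² φ + x² φ + π²β² |φ|⁴ φ − g̃ |φ|² φ, where g̃ = g ∫_ℝ u_ε⁴ and u_ε(y) = (πε)^{-1/4} exp(−y²/(2ε)). Set f(y) = ∫_ℝ sgn(y−y′) u_ε(y′)² dy′, Φ(t,x,y) = φ(t,x) u_ε(y), T(t,x,y) = (−πβ f(y)|φ(t,x)|², 0), V_ε(x,y) = x² + y²/ε² − 1/ε, j₁(t,x,y) = ( Im( φ̄ ∂_x φ )(t,x) − πβ f(y) |φ(t,x)|⁴ ) u_ε(y)², and (T₀ ⋆ j)(t,x,y) = −π ∫_ℝ sgn(y−y′) j₁(t,x,y′) dy′. Then for all t and x, i ∂_t φ(t,x) = ∫_ℝ [ (−i∇ + T)² Φ + V_ε Φ − g |Φ|² Φ − 2β (T₀ ⋆ j) Φ ](t,x,y) u_ε(y) dy, i.e. the quasi-1D ansatz satisfies the 2D Chern-Simons-Schrödinger equation projected onto the transverse ground state u_ε. -/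

import Mathlib

open MeasureTheory

/-- The Gaussian ground state `u_ε(y) = (πε)^{-1/4} exp(−y²/(2ε))`. -/
noncomputable def uGauss (ε y : ℝ) : ℝ :=
  (Real.pi * ε) ^ (-(1/4 : ℝ)) * Real.exp (-(y^2) / (2*ε))

/-- `f(y) = ∫ sgn(y−y′) u_ε(y′)² dy′`. -/
noncomputable def fSgn (ε y : ℝ) : ℝ :=
  ∫ y' : ℝ, Real.sign (y - y') * (uGauss ε y')^2

/-- The quasi-1D ansatz `Φ(x,y) = φ(x) u_ε(y)` for a 1D profile `φ`. -/
noncomputable def PhiAnsatz (ε : ℝ) (φ : ℝ → ℂ) (p : ℝ × ℝ) : ℂ :=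
  φ p.1 * ((uGauss ε p.2 : ℝ) : ℂ)

/-- The longitudinal covariant operator `−i∂_x + T₁` in the 1D-adapted gauge
`T₁ = −πβ f(y)|φ(x)|²`. -/
noncomputable def opB (ε β : ℝ) (φ : ℝ → ℂ) (Ψ : ℝ × ℝ → ℂ) (p : ℝ × ℝ) : ℂ :=
  -Complex.I * fderiv ℝ Ψ p (1, 0)
    + ((-Real.pi * β * fSgn ε p.2 * ‖φ p.1‖^2 : ℝ) : ℂ) * Ψ p

/-- The magnetic Laplacian of the ansatz in the 1D-adapted gauge:
`(−i∇ + T)²Φ = (−i∂_x + T₁)² Φ − ∂_y² Φ`. -/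
noncomputable def magLapAnsatz (ε β : ℝ) (φ : ℝ → ℂ) (p : ℝ × ℝ) : ℂ :=
  opB ε β φ (opB ε β φ (PhiAnsatz ε φ)) p
    - fderiv ℝ (fun q => fderiv ℝ (PhiAnsatz ε φ) q (0, 1)) p (0, 1)

/-- First component of the current of the quasi-1D ansatz:
`j₁(x,y) = (Im(φ̄(x) φ'(x)) − πβ f(y)|φ(x)|⁴) u_ε(y)²`. -/
noncomputable def j1 (ε β : ℝ) (φ : ℝ → ℂ) (x y : ℝ) : ℝ :=
  (((starRingEnd ℂ) (φ x) * deriv φ x).im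
    - Real.pi * β * fSgn ε y * ‖φ x‖^4) * (uGauss ε y)^2

lemma qs_sign_int (h H : ℝ → ℝ) (A B : ℝ) (hi : Integrable h) (hd : ∀ y, HasDerivAt H (h y) y)
    (hA : Filter.Tendsto H Filter.atBot (nhds A)) (hB : Filter.Tendsto H Filter.atTop (nhds B))
    (y : ℝ) : ∫ z : ℝ, Real.sign (y - z) * h z = 2 * H y - A - B := by
  have e : (fun z : ℝ => Real.sign (y - z) * h z)
      = fun z => (Set.Iio y).indicator h z - (Set.Ioi y).indicator h z := by
    funext z
    rcases lt_trichotomy z y with hz | hz | hz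
    · rw [Real.sign_of_pos (by linarith)]
      simp [Set.indicator, hz, hz.not_gt]
    · subst hz; simp
    · rw [Real.sign_of_neg (by linarith)]
      simp [Set.indicator, hz, hz.not_gt]
  rw [e, integral_sub (hi.indicator measurableSet_Iio) (hi.indicator measurableSet_Ioi),
    integral_indicator measurableSet_Iio, integral_indicator measurableSet_Ioi,
    ← integral_Iic_eq_integral_Iio,
    integral_Iic_of_hasDerivAt_of_tendsto' (fun x _ => hd x) hi.integrableOn hA,
    integral_Ioi_of_hasDerivAt_of_tendsto' (fun x _ => hd x) hi.integrableOn hB]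
  ring

lemma qs_w_eq (ε : ℝ) (hε : 0 < ε) (y : ℝ) :
    (uGauss ε y)^2 = (Real.sqrt (Real.pi * ε))⁻¹ * Real.exp (-(1/ε) * y^2) := by
  have hp : 0 < Real.pi * ε := by positivity
  unfold uGauss
  rw [mul_pow, ← Real.exp_nat_mul, ← Real.rpow_natCast, ← Real.rpow_mul hp.le,
    Real.sqrt_eq_rpow, ← Real.rpow_neg hp.le]
  congr 1
  · norm_num
  · congr 1; push_cast; field_simp

lemma qs_w_int (ε : ℝ) (hε : 0 < ε) : Integrable (fun y => (uGauss ε y)^2) := by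
  simp_rw [qs_w_eq ε hε]
  exact (integrable_exp_neg_mul_sq (by positivity)).const_mul _

lemma qs_w_one (ε : ℝ) (hε : 0 < ε) : ∫ y, (uGauss ε y)^2 = 1 := by
  have hp : 0 < Real.pi * ε := by positivity
  simp_rw [qs_w_eq ε hε]
  rw [integral_const_mul, integral_gaussian]
  have : Real.pi / (1/ε) = Real.pi * ε := by field_simp
  rw [this]
  exact inv_mul_cancel₀ (Real.sqrt_pos.mpr hp).ne'

lemma qs_u_cont (ε : ℝ) : Continuous (uGauss ε) := by
  unfold uGauss; fun_prop

lemma qs_u_d (ε : ℝ) (y : ℝ) : HasDerivAt (uGauss ε) (-(y/ε) * uGauss ε y) y := by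
  unfold uGauss
  have h1 : HasDerivAt (fun y : ℝ => -(y^2) / (2*ε)) (-(y/ε)) y := by
    have := (((hasDerivAt_id y).fun_pow 2).fun_neg).div_const (2*ε)
    refine this.congr_deriv ?_
    simp only [id]
    push_cast
    field_simp
  refine (h1.exp.const_mul ((Real.pi * ε) ^ (-(1/4 : ℝ)))).congr_deriv ?_
  ring

lemma qs_w4_int (ε : ℝ) (hε : 0 < ε) : Integrable (fun y => (uGauss ε y)^4) := by
  have : (fun y => (uGauss ε y)^4) = fun y => ((Real.sqrt (Real.pi * ε))⁻¹)^2 * Real.exp (-(2/ε) * y^2) := by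
    funext y
    rw [show (uGauss ε y)^4 = ((uGauss ε y)^2)^2 by ring, qs_w_eq ε hε, mul_pow, ← Real.exp_nat_mul]
    congr 2
    push_cast; ring
  rw [this]
  exact (integrable_exp_neg_mul_sq (by positivity)).const_mul _

lemma qs_f (ε : ℝ) (hε : 0 < ε) :
    (∀ y, HasDerivAt (fSgn ε) (2 * (uGauss ε y)^2) y) ∧
    Filter.Tendsto (fSgn ε) Filter.atBot (nhds (-1)) ∧
    Filter.Tendsto (fSgn ε) Filter.atTop (nhds 1) := by
  set w : ℝ → ℝ := fun y => (uGauss ε y)^2 with hw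
  have wi : Integrable w := qs_w_int ε hε
  have wc : Continuous w := (qs_u_cont ε).pow 2
  set H : ℝ → ℝ := fun y => ∫ z in (0:ℝ)..y, w z with hH
  have hd : ∀ y, HasDerivAt H (w y) y := fun y =>
    intervalIntegral.integral_hasDerivAt_right (wc.intervalIntegrable _ _)
      (wc.stronglyMeasurableAtFilter _ _) wc.continuousAt
  have hB : Filter.Tendsto H Filter.atTop (nhds (∫ z in Set.Ioi 0, w z)) :=
    intervalIntegral_tendsto_integral_Ioi 0 wi.integrableOn Filter.tendsto_id
  have hA : Filter.Tendsto H Filter.atBot (nhds (-∫ z in Set.Iic 0, w z)) := by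
    have := (intervalIntegral_tendsto_integral_Iic 0 wi.integrableOn Filter.tendsto_id).neg
    refine this.congr fun y => ?_
    simp only [id, hH]
    rw [intervalIntegral.integral_symm, neg_neg]
  have hone : (∫ z in Set.Iic 0, w z) + ∫ z in Set.Ioi 0, w z = 1 := by
    rw [intervalIntegral.integral_Iic_add_Ioi wi.integrableOn wi.integrableOn]
    exact qs_w_one ε hε
  generalize (∫ z in Set.Iic 0, w z) = A at *
  generalize (∫ z in Set.Ioi 0, w z) = B at *
  have hf : fSgn ε = fun y => 2 * H y - (-A) - B := by
    funext y
    exact qs_sign_int w H _ _ wi hd hA hB y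
  rw [hf]
  refine ⟨fun y => (((hd y).const_mul 2).sub_const _).sub_const _, ?_, ?_⟩
  · convert ((hA.const_mul 2).sub_const (-A)).sub_const B using 2
    linarith
  · convert ((hB.const_mul 2).sub_const (-A)).sub_const B using 2
    linarith

lemma qs_f_cont (ε : ℝ) (hε : 0 < ε) : Continuous (fSgn ε) :=
  continuous_iff_continuousAt.mpr fun y => ((qs_f ε hε).1 y).continuousAt

lemma qs_f_mono (ε : ℝ) (hε : 0 < ε) : Monotone (fSgn ε) := by
  apply monotone_of_deriv_nonneg (fun y => ((qs_f ε hε).1 y).differentiableAt)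
  intro y
  rw [((qs_f ε hε).1 y).deriv]
  positivity

lemma qs_f_bd (ε : ℝ) (hε : 0 < ε) (y : ℝ) : ‖fSgn ε y‖ ≤ 1 := by
  rw [Real.norm_eq_abs, abs_le]
  exact ⟨(qs_f_mono ε hε).le_of_tendsto (qs_f ε hε).2.1 y,
    (qs_f_mono ε hε).ge_of_tendsto (qs_f ε hε).2.2 y⟩

lemma qs_fw_int (ε : ℝ) (hε : 0 < ε) : Integrable (fun y => fSgn ε y * (uGauss ε y)^2) :=
  (qs_w_int ε hε).bdd_mul (qs_f_cont ε hε).aestronglyMeasurable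
    (Filter.Eventually.of_forall (qs_f_bd ε hε))

lemma qs_ffw_int (ε : ℝ) (hε : 0 < ε) : Integrable (fun y => fSgn ε y ^2 * (uGauss ε y)^2) := by
  have := (qs_fw_int ε hε).bdd_mul (qs_f_cont ε hε).aestronglyMeasurable
    (Filter.Eventually.of_forall (qs_f_bd ε hε))
  refine this.congr (Filter.Eventually.of_forall fun y => ?_)
  simp only; ring

lemma qs_f2_d (ε : ℝ) (hε : 0 < ε) (y : ℝ) :
    HasDerivAt (fun y => fSgn ε y ^ 2 / 4) (fSgn ε y * (uGauss ε y)^2) y := by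
  refine ((((qs_f ε hε).1 y).fun_pow 2).div_const 4).congr_deriv ?_
  push_cast; ring

lemma qs_f3_d (ε : ℝ) (hε : 0 < ε) (y : ℝ) :
    HasDerivAt (fun y => fSgn ε y ^ 3 / 6) (fSgn ε y ^ 2 * (uGauss ε y)^2) y := by
  refine ((((qs_f ε hε).1 y).fun_pow 3).div_const 6).congr_deriv ?_
  push_cast; ring

lemma qs_fw (ε : ℝ) (hε : 0 < ε) : ∫ y, fSgn ε y * (uGauss ε y)^2 = 0 := by
  rw [integral_of_hasDerivAt_of_tendsto (qs_f2_d ε hε) (qs_fw_int ε hε)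
    (((qs_f ε hε).2.1.pow 2).div_const 4) (((qs_f ε hε).2.2.pow 2).div_const 4)]
  norm_num

lemma qs_ffw (ε : ℝ) (hε : 0 < ε) : ∫ y, fSgn ε y ^ 2 * (uGauss ε y)^2 = 1/3 := by
  rw [integral_of_hasDerivAt_of_tendsto (qs_f3_d ε hε) (qs_ffw_int ε hε)
    (((qs_f ε hε).2.1.pow 3).div_const 6) (((qs_f ε hε).2.2.pow 3).div_const 6)]
  norm_num

lemma qs_G (ε : ℝ) (hε : 0 < ε) (y : ℝ) :
    ∫ z : ℝ, Real.sign (y - z) * (fSgn ε z * (uGauss ε z)^2) = (fSgn ε y ^ 2 - 1) / 2 := by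
  rw [qs_sign_int _ _ _ _ (qs_fw_int ε hε) (qs_f2_d ε hε)
    (((qs_f ε hε).2.1.pow 2).div_const 4) (((qs_f ε hε).2.2.pow 2).div_const 4)]
  ring

lemma qs_sign_integrable (h : ℝ → ℝ) (hi : Integrable h) (y : ℝ) :
    Integrable fun z : ℝ => Real.sign (y - z) * h z := by
  have e : (fun z : ℝ => Real.sign (y - z) * h z)
      = fun z => (Set.Iio y).indicator h z - (Set.Ioi y).indicator h z := by
    funext z
    rcases lt_trichotomy z y with hz | hz | hz
    · rw [Real.sign_of_pos (by linarith)]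
      simp [Set.indicator, hz, hz.not_gt]
    · subst hz; simp
    · rw [Real.sign_of_neg (by linarith)]
      simp [Set.indicator, hz, hz.not_gt]
  rw [e]
  exact (hi.indicator measurableSet_Iio).sub (hi.indicator measurableSet_Ioi)

lemma qs_j (ε β : ℝ) (hε : 0 < ε) (φ : ℝ → ℂ) (x y : ℝ) :
    ∫ z : ℝ, Real.sign (y - z) * j1 ε β φ x z
      = ((starRingEnd ℂ) (φ x) * deriv φ x).im * fSgn ε y
        - Real.pi * β * ‖φ x‖^4 * ((fSgn ε y ^ 2 - 1) / 2) := by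
  rw [← qs_G ε hε]
  conv_rhs => rw [fSgn]
  rw [← integral_const_mul, ← integral_const_mul, ← integral_sub
    ((qs_sign_integrable _ (qs_w_int ε hε) y).const_mul _)
    ((qs_sign_integrable _ (qs_fw_int ε hε) y).const_mul _)]
  congr 1
  funext z
  unfold j1
  ring

lemma qs_fd1 (Ψ : ℝ × ℝ → ℂ) (x y : ℝ) (d : ℂ) (h : DifferentiableAt ℝ Ψ (x, y))
    (hd : HasDerivAt (fun s => Ψ (s, y)) d x) : fderiv ℝ Ψ (x, y) (1, 0) = d := by
  have h2 : HasDerivAt (fun s : ℝ => (s, y)) ((1:ℝ), (0:ℝ)) x :=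
    (hasDerivAt_id x).prodMk (hasDerivAt_const x y)
  exact (h.hasFDerivAt.comp_hasDerivAt x h2).unique hd

lemma qs_fd2 (Ψ : ℝ × ℝ → ℂ) (x y : ℝ) (d : ℂ) (h : DifferentiableAt ℝ Ψ (x, y))
    (hd : HasDerivAt (fun s => Ψ (x, s)) d y) : fderiv ℝ Ψ (x, y) (0, 1) = d := by
  have h2 : HasDerivAt (fun s : ℝ => (x, s)) ((0:ℝ), (1:ℝ)) y :=
    (hasDerivAt_const y x).prodMk (hasDerivAt_id y)
  exact (h.hasFDerivAt.comp_hasDerivAt y h2).unique hd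

lemma qs_mag (ε β : ℝ) (hε : 0 < ε) (φ : ℝ → ℂ) (h0 : Differentiable ℝ φ)
    (h1 : Differentiable ℝ (deriv φ)) (x : ℝ) :
    ∃ K : ℂ, ∀ y, magLapAnsatz ε β φ (x, y)
      = (-(deriv (deriv φ) x) + K * fSgn ε y
        + ((Real.pi^2 * β^2 * ‖φ x‖^4 : ℝ) : ℂ) * φ x * (fSgn ε y : ℂ)^2
        - ((y^2/ε^2 - 1/ε : ℝ) : ℂ) * φ x) * (uGauss ε y : ℂ) := by
  have uD : Differentiable ℝ (fun y => (uGauss ε y : ℂ)) :=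
    fun y => (qs_u_d ε y).ofReal_comp.differentiableAt
  have fD : Differentiable ℝ (fun y => (fSgn ε y : ℂ)) :=
    fun y => ((qs_f ε hε).1 y).ofReal_comp.differentiableAt
  have nD : Differentiable ℝ (fun x => ((‖φ x‖^2 : ℝ) : ℂ)) :=
    fun x => ((h0 x).hasDerivAt.norm_sq).ofReal_comp.differentiableAt
  have PD : Differentiable ℝ (PhiAnsatz ε φ) := by
    unfold PhiAnsatz
    exact (h0.comp differentiable_fst).mul (uD.comp differentiable_snd)
  have F1 : ∀ x y, fderiv ℝ (PhiAnsatz ε φ) (x, y) (1, 0) = deriv φ x * (uGauss ε y : ℂ) :=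
    fun x y => qs_fd1 _ _ _ _ (PD _) (by
      exact (h0 x).hasDerivAt.mul_const (uGauss ε y : ℂ))
  have F2 : ∀ x y, fderiv ℝ (PhiAnsatz ε φ) (x, y) (0, 1)
      = φ x * ((-(y/ε) * uGauss ε y : ℝ) : ℂ) :=
    fun x y => qs_fd2 _ _ _ _ (PD _) (by
      exact (qs_u_d ε y).ofReal_comp.const_mul (φ x))
  have B1 : opB ε β φ (PhiAnsatz ε φ) = fun p : ℝ × ℝ =>
      -Complex.I * (deriv φ p.1 * (uGauss ε p.2 : ℂ))
      + (-Real.pi * β : ℂ) * (fSgn ε p.2 : ℂ) * ((‖φ p.1‖^2 : ℝ) : ℂ) * (φ p.1 * (uGauss ε p.2 : ℂ)) := by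
    funext ⟨x, y⟩
    simp only [opB, F1, PhiAnsatz]
    push_cast
    ring
  have BD : Differentiable ℝ (opB ε β φ (PhiAnsatz ε φ)) := by
    rw [B1]
    have a1 := h0.comp (differentiable_fst (𝕜 := ℝ) (E := ℝ) (F := ℝ))
    have a2 := h1.comp (differentiable_fst (𝕜 := ℝ) (E := ℝ) (F := ℝ))
    have a3 := nD.comp (differentiable_fst (𝕜 := ℝ) (E := ℝ) (F := ℝ))
    have a4 := uD.comp (differentiable_snd (𝕜 := ℝ) (E := ℝ) (F := ℝ))
    have a5 := fD.comp (differentiable_snd (𝕜 := ℝ) (E := ℝ) (F := ℝ))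
    exact ((a2.mul a4).const_mul _).add (((a5.const_mul _).mul a3).mul (a1.mul a4))
  refine ⟨-Complex.I * (-Real.pi * β : ℂ) * (deriv (fun x => ((‖φ x‖^2 : ℝ) : ℂ)) x * φ x
    + 2 * ((‖φ x‖^2 : ℝ) : ℂ) * deriv φ x), fun y => ?_⟩
  have G1 := qs_fd1 _ x y (-Complex.I * (deriv (deriv φ) x * (uGauss ε y : ℂ))
      + (((-Real.pi * β : ℂ) * (fSgn ε y : ℂ) * deriv (fun x => ((‖φ x‖^2 : ℝ) : ℂ)) x) * (φ x * (uGauss ε y : ℂ))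
      + ((-Real.pi * β : ℂ) * (fSgn ε y : ℂ) * ((‖φ x‖^2 : ℝ) : ℂ)) * (deriv φ x * (uGauss ε y : ℂ))))
      (BD (x, y)) (by
    rw [B1]
    exact (((h1 x).hasDerivAt.mul_const (uGauss ε y : ℂ)).const_mul (-Complex.I)).fun_add
      (((nD x).hasDerivAt.const_mul ((-Real.pi * β : ℂ) * (fSgn ε y : ℂ))).fun_mul
        ((h0 x).hasDerivAt.mul_const (uGauss ε y : ℂ))))
  have E2 : (fun q : ℝ × ℝ => fderiv ℝ (PhiAnsatz ε φ) q (0, 1))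
      = fun q => φ q.1 * ((-(q.2/ε) * uGauss ε q.2 : ℝ) : ℂ) := by
    funext ⟨x, y⟩
    exact F2 x y
  have vd : ∀ y, HasDerivAt (fun y => ((-(y/ε) * uGauss ε y : ℝ) : ℂ))
      (((-(1/ε)) * uGauss ε y + (-(y/ε)) * (-(y/ε) * uGauss ε y) : ℝ) : ℂ) y := fun y =>
    ((((hasDerivAt_id y).div_const ε).neg).mul (qs_u_d ε y)).ofReal_comp
  have vD : Differentiable ℝ (fun y => ((-(y/ε) * uGauss ε y : ℝ) : ℂ)) :=
    fun y => (vd y).differentiableAt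
  have G2 := qs_fd2 (fun q : ℝ × ℝ => φ q.1 * ((-(q.2/ε) * uGauss ε q.2 : ℝ) : ℂ)) x y _
    (((h0.comp differentiable_fst).mul (vD.comp differentiable_snd)) (x, y))
    ((vd y).const_mul (φ x))
  unfold magLapAnsatz
  rw [E2, G2, opB, G1, B1]
  push_cast
  ring_nf
  simp only [Complex.I_sq]
  ring

/-- Main result: if `φ(t,x)` is a smooth solution of the 1D cubic-quintic NLS
`i∂_t φ = −∂_x²φ + x²φ + π²β²|φ|⁴φ − g̃|φ|²φ` with `g̃ = g ∫ u_ε⁴`, then the quasi-1D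
ansatz `Φ = φ(t,x) u_ε(y)` satisfies the 2D Chern-Simons-Schrödinger equation (in the
1D-adapted gauge, with trap `V_ε = x² + y²/ε² − 1/ε`) projected onto the transverse
ground state `u_ε`. -/
theorem quasi_1D_solution (ε β g : ℝ) (hε : 0 < ε) (φ : ℝ → ℝ → ℂ)
    (hφ : ContDiff ℝ (⊤ : ℕ∞) (fun q : ℝ × ℝ => φ q.1 q.2))
    (heq : ∀ (t x : ℝ),
      Complex.I * deriv (fun s => φ s x) t
        = -(deriv (deriv (φ t)) x) + ((x^2 : ℝ) : ℂ) * φ t x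
          + ((Real.pi^2 * β^2 * ‖φ t x‖^4 : ℝ) : ℂ) * φ t x
          - ((g * (∫ y : ℝ, (uGauss ε y)^4) * ‖φ t x‖^2 : ℝ) : ℂ) * φ t x) :
    ∀ (t x : ℝ),
      Complex.I * deriv (fun s => φ s x) t
        = ∫ y : ℝ,
            (magLapAnsatz ε β (φ t) (x, y)
              + ((x^2 + y^2 / ε^2 - 1/ε : ℝ) : ℂ) * PhiAnsatz ε (φ t) (x, y)
              - ((g : ℝ) : ℂ) * ((‖PhiAnsatz ε (φ t) (x, y)‖^2 : ℝ) : ℂ)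
                  * PhiAnsatz ε (φ t) (x, y)
              - ((2 * β : ℝ) : ℂ)
                  * ((-Real.pi * ∫ y' : ℝ, Real.sign (y - y') * j1 ε β (φ t) x y' : ℝ) : ℂ)
                  * PhiAnsatz ε (φ t) (x, y))
            * ((uGauss ε y : ℝ) : ℂ) := by
  intro t x
  rw [heq t x]
  have hs : ContDiff ℝ (⊤ : ℕ∞) (φ t) := hφ.comp (contDiff_const.prodMk contDiff_id)
  have h0 : Differentiable ℝ (φ t) := hs.differentiable (by simp)
  have h1 : Differentiable ℝ (deriv (φ t)) :=
    ((contDiff_infty_iff_deriv.mp hs).2).differentiable (by simp)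
  obtain ⟨K, hK⟩ := qs_mag ε β hε (φ t) h0 h1 x
  have key : ∀ y, (magLapAnsatz ε β (φ t) (x, y)
              + ((x^2 + y^2 / ε^2 - 1/ε : ℝ) : ℂ) * PhiAnsatz ε (φ t) (x, y)
              - ((g : ℝ) : ℂ) * ((‖PhiAnsatz ε (φ t) (x, y)‖^2 : ℝ) : ℂ)
                  * PhiAnsatz ε (φ t) (x, y)
              - ((2 * β : ℝ) : ℂ)
                  * ((-Real.pi * ∫ y' : ℝ, Real.sign (y - y') * j1 ε β (φ t) x y' : ℝ) : ℂ)
                  * PhiAnsatz ε (φ t) (x, y))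
            * ((uGauss ε y : ℝ) : ℂ)
      = (-(deriv (deriv (φ t)) x) + (x:ℂ)^2 * φ t x
            + (Real.pi^2 * β^2 * ‖φ t x‖^4 : ℂ) * φ t x) * ((uGauss ε y ^ 2 : ℝ) : ℂ)
        + (K + 2 * β * Real.pi * (((starRingEnd ℂ) (φ t x) * deriv (φ t) x).im : ℂ) * φ t x)
            * ((fSgn ε y * uGauss ε y ^ 2 : ℝ) : ℂ)
        + (-(g * ‖φ t x‖^2 * φ t x : ℂ)) * ((uGauss ε y ^ 4 : ℝ) : ℂ) := by
    intro y
    rw [hK y, qs_j ε β hε]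
    simp only [PhiAnsatz, norm_mul, Complex.norm_real, Real.norm_eq_abs, mul_pow, sq_abs]
    push_cast
    ring
  simp_rw [key]
  have i1 : Integrable (fun y => (((uGauss ε y ^ 2 : ℝ)) : ℂ)) := (qs_w_int ε hε).ofReal (𝕜 := ℂ)
  have i2 : Integrable (fun y => (((fSgn ε y * uGauss ε y ^ 2 : ℝ)) : ℂ)) := (qs_fw_int ε hε).ofReal (𝕜 := ℂ)
  have i4 : Integrable (fun y => (((uGauss ε y ^ 4 : ℝ)) : ℂ)) := (qs_w4_int ε hε).ofReal (𝕜 := ℂ)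
  rw [integral_add ((i1.const_mul _).fun_add (i2.const_mul _)) (i4.const_mul _),
    integral_add (i1.const_mul _) (i2.const_mul _)]
  simp only [integral_const_mul]
  rw [integral_complex_ofReal, integral_complex_ofReal, integral_complex_ofReal,
    qs_w_one ε hε, qs_fw ε hε]
  push_cast
  ring
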